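/- For k odd and the path sequence K_n consisting of n repetitions of J = ⟨k+1,k,…,1,2,…,k⟩^h with h = (k+1)/2, FIFO faults exactly k+1 times on each copy of J (after the initializing prefix R), so FIFO's cost on K_n is (k+1)n while FWF's cost is 2khn, and lim (FWF − FIFO)/|K_n| = (k−1)/k. -/

import Mathlib

/-- One step of LRU with cache size `k`: cache is a list of pages, most
recently used first; returns the new cache and whether the request faulted. -/
def lruStep (k : ℕ) (c : List ℕ) (p : ℕ) : List ℕ × Bool :=
  if p ∈ c then (p :: c.erase p, false) else ((p :: c).take k, true)

/-- One step of FIFO with cache size `k`: cache is a list of pages, most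
recently entered first. -/
def fifoStep (k : ℕ) (c : List ℕ) (p : ℕ) : List ℕ × Bool :=
  if p ∈ c then (c, false) else ((p :: c).take k, true)

/-- One step of FWF (flush-when-full) with cache size `k`. -/
def fwfStep (k : ℕ) (c : List ℕ) (p : ℕ) : List ℕ × Bool :=
  if p ∈ c then (c, false)
  else if c.length = k then ([p], true) else (p :: c, true)

/-- Number of faults incurred by an algorithm given by `step`, starting from
an empty cache, on the request sequence `I`. -/
def runCost (step : List ℕ → ℕ → List ℕ × Bool) (I : List ℕ) : ℕ :=
  (I.foldl (fun s p => ((step s.1 p).1, s.2 + if (step s.1 p).2 then 1 else 0))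
    (([] : List ℕ), 0)).2

/-- Number of faults of LRU with cache size `k` on sequence `I`. -/
def lruCost (k : ℕ) (I : List ℕ) : ℕ := runCost (lruStep k) I

/-- Number of faults of FIFO with cache size `k` on sequence `I`. -/
def fifoCost (k : ℕ) (I : List ℕ) : ℕ := runCost (fifoStep k) I

/-- Number of faults of FWF with cache size `k` on sequence `I`. -/
def fwfCost (k : ℕ) (I : List ℕ) : ℕ := runCost (fwfStep k) I

/-- `n`-fold concatenation of the list `l`. -/
def repeatList (l : List ℕ) (n : ℕ) : List ℕ := (List.replicate n l).flatten

/-- `S_i = ⟨h+i, h+i−1, …, h−i, h−i+1, …, h+i⟩`. -/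
def pathS (h i : ℕ) : List ℕ :=
  (List.range' (h - i) (2 * i + 1)).reverse ++ List.range' (h - i + 1) (2 * i)

/-- The initializing prefix `R = ⟨h, S_1, S_2, …, S_{h−1}⟩`, `h = (k+1)/2`. -/
def pathR (k : ℕ) : List ℕ :=
  (k + 1) / 2 :: ((List.range ((k + 1) / 2 - 1)).map (fun j => pathS ((k + 1) / 2) (j + 1))).flatten

/-- The block `⟨k+1, k, …, 1, 2, …, k⟩` of length `2k`. -/
def pathBlock7 (k : ℕ) : List ℕ := (List.range' 1 (k + 1)).reverse ++ List.range' 2 (k - 1)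

/-- `J = ⟨k+1, k, …, 1, 2, …, k⟩^h` with `h = (k+1)/2`. -/
def pathJ (k : ℕ) : List ℕ := repeatList (pathBlock7 k) ((k + 1) / 2)

/-- `I_n = ⟨R, K_n⟩` where `K_n = J^n`. -/
def pathI7 (k n : ℕ) : List ℕ := pathR k ++ repeatList (pathJ k) n

/-- One step of the cost-counting run underlying `runCost`, on a state (cache, faults so far). -/
def costStep (step : List ℕ → ℕ → List ℕ × Bool) (s : List ℕ × ℕ) (p : ℕ) : List ℕ × ℕ :=
  ((step s.1 p).1, s.2 + if (step s.1 p).2 then 1 else 0)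

lemma runCost_eq_foldl (step : List ℕ → ℕ → List ℕ × Bool) (I : List ℕ) :
    runCost step I = (I.foldl (costStep step) ([], 0)).2 := rfl

lemma repeatList_succ (l : List ℕ) (n : ℕ) : repeatList l (n + 1) = l ++ repeatList l n := by
  simp [repeatList, List.replicate_succ]

lemma length_repeatList (l : List ℕ) (n : ℕ) : (repeatList l n).length = n * l.length := by
  simp [repeatList]

/-- A sequence that costs `d` and restores the cache can be repeated `n` times for `n * d`. -/
lemma foldl_repeatList_of_fixed (f : List ℕ × ℕ → ℕ → List ℕ × ℕ) (l : List ℕ)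
    (P : List ℕ → Prop) (d : ℕ)
    (h : ∀ c a, P c → ∃ c', P c' ∧ l.foldl f (c, a) = (c', a + d)) (n : ℕ) :
    ∀ c a, P c → ∃ c', P c' ∧ (repeatList l n).foldl f (c, a) = (c', a + d * n) := by
  induction n with
  | zero => exact fun c a hc => ⟨c, hc, by simp [repeatList]⟩
  | succ n ih =>
    intro c a hc
    obtain ⟨c₁, hc₁, h₁⟩ := h c a hc
    obtain ⟨c₂, hc₂, h₂⟩ := ih c₁ (a + d) hc₁
    refine ⟨c₂, hc₂, ?_⟩
    rw [repeatList_succ, List.foldl_append, h₁, h₂]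
    congr 1
    ring

lemma foldl_costStep_of_subset (step : List ℕ → ℕ → List ℕ × Bool)
    (hhit : ∀ c p, p ∈ c → step c p = (c, false)) (c : List ℕ) (a : ℕ) (A : List ℕ)
    (hA : ∀ p ∈ A, p ∈ c) : A.foldl (costStep step) (c, a) = (c, a) := by
  induction A with
  | nil => rfl
  | cons p A ih =>
    have hp : costStep step (c, a) p = (c, a) := by
      simp [costStep, hhit c p (hA p (by simp))]
    rw [List.foldl_cons, hp]
    exact ih fun q hq => hA q (by simp [hq])

lemma fifoStep_of_mem (k : ℕ) (c : List ℕ) (p : ℕ) (hp : p ∈ c) :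
    fifoStep k c p = (c, false) := by
  simp [fifoStep, hp]

lemma fwfStep_of_mem (k : ℕ) (c : List ℕ) (p : ℕ) (hp : p ∈ c) :
    fwfStep k c p = (c, false) := by
  simp [fwfStep, hp]

lemma fifoStep_of_notMem_of_lt (k : ℕ) (c : List ℕ) (p : ℕ) (hp : p ∉ c) (hc : c.length < k) :
    fifoStep k c p = (p :: c, true) := by
  have : (p :: c).take k = p :: c := List.take_of_length_le (by simpa using hc)
  simp [fifoStep, hp, this]

lemma fwfStep_of_notMem_of_lt (k : ℕ) (c : List ℕ) (p : ℕ) (hp : p ∉ c) (hc : c.length < k) :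
    fwfStep k c p = (p :: c, true) := by
  simp [fwfStep, hp, hc.ne]

/-- The list `⟨m+1+j, m+2-j, …, m+2, m+1⟩` alternating outwards from the middle page `m + 1`. -/
def zigzag (m : ℕ) : ℕ → List ℕ
  | 0 => []
  | j + 1 => (m + j + 2) :: (m + 1 - j) :: zigzag m j

/-- The list `⟨1, 2m+1, 2, 2m, …, t, 2m+2-t⟩` alternating inwards from the end pages. -/
def zagIn (m : ℕ) : ℕ → List ℕ
  | 0 => []
  | t + 1 => zagIn m t ++ [t + 1, 2 * m + 1 - t]

lemma zagIn_append_zigzag (m t : ℕ) : ∀ j, t + j = m →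
    zagIn m t ++ (t + 1) :: zigzag m j = 1 :: zigzag m m := by
  induction t with
  | zero =>
    intro j hj
    obtain rfl : j = m := by omega
    simp [zagIn]
  | succ t ih =>
    intro j hj
    rw [← ih (j + 1) (by omega), zagIn, zigzag, show m + j + 2 = 2 * m + 1 - t by omega,
      show m + 1 - j = t + 1 + 1 by omega]
    simp

lemma cons_zigzag_perm (m i : ℕ) (hi : i ≤ m) :
    ((m + 1 - i) :: zigzag m i).Perm (List.range' (m + 1 - i) (2 * i + 1)) := by
  induction i with
  | zero => simp [zigzag]
  | succ i ih =>
    have h := ih (by omega)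
    rw [zigzag, show 2 * (i + 1) + 1 = (2 * i + 1 + 1) + 1 by ring, List.range'_succ,
      List.range'_concat, show m + 1 - (i + 1) + 1 = m + 1 - i by omega,
      show m + 1 - i + 1 * (2 * i + 1) = m + i + 2 by omega]
    exact ((h.cons _).trans (List.perm_append_singleton _ _).symm).cons _

lemma foldl_pathS (step : List ℕ → ℕ → List ℕ × Bool) (m i a : ℕ) (hi : i < m)
    (hhit : ∀ c p, p ∈ c → step c p = (c, false))
    (hmiss : ∀ c p, p ∉ c → c.length < 2 * m + 1 → step c p = (p :: c, true)) :
    (pathS (m + 1) (i + 1)).foldl (costStep step) ((m + 1 - i) :: zigzag m i, a) =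
      ((m + 1 - (i + 1)) :: zigzag m (i + 1), a + 2) := by
  have hperm := cons_zigzag_perm m i hi.le
  have hmem : ∀ p, p ∈ (m + 1 - i) :: zigzag m i ↔ m + 1 - i ≤ p ∧ p < m + i + 2 := by
    intro p
    rw [hperm.mem_iff, List.mem_range'_1]
    omega
  have hlen : ((m + 1 - i) :: zigzag m i).length = 2 * i + 1 := by
    simpa using hperm.length_eq
  have hz : zigzag m (i + 1) = (m + i + 2) :: (m + 1 - i) :: zigzag m i := rfl
  set c := (m + 1 - i) :: zigzag m i with hc
  have hS : pathS (m + 1) (i + 1) = (m + i + 2) ::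
      ((List.range' (m + 1 - i) (2 * i + 1)).reverse ++
        ((m + 1 - (i + 1)) :: List.range' (m + 1 - i) (2 * (i + 1)))) := by
    rw [pathS, show 2 * (i + 1) + 1 = (2 * i + 1 + 1) + 1 by ring, List.range'_succ,
      List.range'_concat, show m + 1 - (i + 1) + 1 = m + 1 - i by omega,
      show m + 1 - i + 1 * (2 * i + 1) = m + i + 2 by omega]
    simp
  have h₁ : costStep step (c, a) (m + i + 2) = ((m + i + 2) :: c, a + 1) := by
    have := hmiss c (m + i + 2) (by rw [hmem]; omega) (by omega)
    simp [costStep, this]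
  have h₂ : costStep step ((m + i + 2) :: c, a + 1) (m + 1 - (i + 1)) =
      ((m + 1 - (i + 1)) :: (m + i + 2) :: c, a + 2) := by
    have := hmiss ((m + i + 2) :: c) (m + 1 - (i + 1))
      (by rw [List.mem_cons, hmem]; omega) (by rw [List.length_cons]; omega)
    simp only [costStep, this, if_true]
  rw [hS, List.foldl_cons, h₁, List.foldl_append,
    foldl_costStep_of_subset step hhit _ _ (List.range' _ _).reverse, List.foldl_cons, h₂, hz,
    foldl_costStep_of_subset step hhit]
  · intro p hp
    rw [List.mem_range'_1] at hp
    rw [List.mem_cons, List.mem_cons, hmem]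
    omega
  · intro p hp
    rw [List.mem_reverse, List.mem_range'_1] at hp
    rw [List.mem_cons, hmem]
    omega

/-- Any algorithm that evicts nothing until its cache is full has the same state after the
initializing prefix. -/
lemma foldl_pathR (step : List ℕ → ℕ → List ℕ × Bool) (m : ℕ)
    (hhit : ∀ c p, p ∈ c → step c p = (c, false))
    (hmiss : ∀ c p, p ∉ c → c.length < 2 * m + 1 → step c p = (p :: c, true)) :
    (pathR (2 * m + 1)).foldl (costStep step) ([], 0) = (1 :: zigzag m m, 2 * m + 1) := by
  have key : ∀ i ≤ m, (((List.range i).map (fun j => pathS (m + 1) (j + 1))).flatten).foldl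
      (costStep step) ([m + 1], 1) = ((m + 1 - i) :: zigzag m i, 2 * i + 1) := by
    intro i
    induction i with
    | zero => simp [zigzag]
    | succ i ih =>
      intro hi
      rw [List.range_succ, List.map_append, List.flatten_append, List.foldl_append,
        ih (by omega)]
      simpa [mul_add, add_right_comm] using foldl_pathS step m i (2 * i + 1) hi hhit hmiss
  have h₀ : costStep step ([], 0) (m + 1) = ([m + 1], 1) := by
    simp [costStep, hmiss [] (m + 1) (by simp) (by simp)]
  rw [pathR, show (2 * m + 1 + 1) / 2 = m + 1 by omega, List.foldl_cons, h₀, Nat.add_sub_cancel,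
    key m le_rfl]
  simp

/-- With `k + 1` pages of which only `x` is missing, FIFO hits on every other page. -/
lemma foldl_fifo_of_hits (k x : ℕ) (c : List ℕ) (a : ℕ) (A : List ℕ)
    (hc : (x :: c).Perm (List.range' 1 (k + 1)))
    (hA : ∀ p ∈ A, 1 ≤ p ∧ p ≤ k + 1 ∧ p ≠ x) :
    A.foldl (costStep (fifoStep k)) (c, a) = (c, a) := by
  refine foldl_costStep_of_subset _ (fifoStep_of_mem k) c a A fun p hp => ?_
  obtain ⟨h1, h2, h3⟩ := hA p hp
  have : p ∈ x :: c := by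
    rw [hc.mem_iff, List.mem_range'_1]
    omega
  simpa [h3] using this

/-- Requesting the missing page `x` evicts the last page `y` of the FIFO cache. -/
lemma costStep_fifo_of_missing (k x y : ℕ) (c : List ℕ) (a : ℕ)
    (hc : (x :: (c ++ [y])).Perm (List.range' 1 (k + 1))) :
    costStep (fifoStep k) (c ++ [y], a) x = (x :: c, a + 1) := by
  have hx : x ∉ c ++ [y] := (List.nodup_cons.1 (hc.nodup_iff.2 List.nodup_range')).1
  have hlen : (x :: c).length = k := by simpa using hc.length_eq
  have : (x :: (c ++ [y])).take k = x :: c := by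
    rw [← List.cons_append, ← hlen, List.take_left]
  simp only [costStep, fifoStep, if_neg hx, this, if_true]

lemma perm_evict (x y : ℕ) (c l : List ℕ) (hc : (x :: (c ++ [y])).Perm l) :
    (y :: x :: c).Perm l :=
  (List.perm_append_singleton y (x :: c)).symm.trans hc

/-- The part `⟨k, …, 1, 2, …, k⟩` of a block after its first request. -/
def blockTail (k : ℕ) : List ℕ := (List.range' 1 k).reverse ++ List.range' 2 (k - 1)

lemma pathBlock7_eq_cons (k : ℕ) : pathBlock7 k = (k + 1) :: blockTail k := by
  rw [pathBlock7, blockTail, List.range'_concat]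
  simp [add_comm]

lemma foldl_fifo_blockTail (m t a : ℕ) (ht : t < m) (c : List ℕ)
    (hc : ((t + 2) :: (c ++ [t + 1, 2 * m + 1 - t])).Perm (List.range' 1 (2 * m + 2))) :
    (blockTail (2 * m + 1)).foldl (costStep (fifoStep (2 * m + 1)))
        (c ++ [t + 1, 2 * m + 1 - t], a) =
      ((2 * m + 1 - t) :: (t + 2) :: c, a + 2) := by
  have e₀ : c ++ [t + 1, 2 * m + 1 - t] = (c ++ [t + 1]) ++ [2 * m + 1 - t] := by simp
  rw [e₀] at hc ⊢
  have hc₁ := perm_evict _ _ _ _ hc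
  rw [← List.cons_append] at hc₁
  have hc₂ := perm_evict _ _ _ _ hc₁
  have hD : List.range' 1 (2 * m + 1) =
      List.range' 1 (t + 1) ++ (t + 2) :: List.range' (t + 3) (2 * m - t - 1) := by
    rw [show t + 3 = t + 2 + 1 by ring, ← List.range'_succ (step := 1),
      show t + 2 = 1 + 1 * (t + 1) by ring, List.range'_append]
    congr 1
    omega
  have hA : List.range' 2 (2 * m + 1 - 1) = List.range' 2 (2 * m - 1 - t) ++
      (2 * m + 1 - t) :: List.range' (2 * m + 2 - t) t := by
    rw [show 2 * m + 2 - t = 2 * m + 1 - t + 1 by omega, ← List.range'_succ (step := 1),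
      show 2 * m + 1 - t = 2 + 1 * (2 * m - 1 - t) by omega, List.range'_append]
    congr 1
    omega
  rw [blockTail, hD, hA, List.foldl_append, List.foldl_append, List.reverse_append,
    List.reverse_cons, List.foldl_append, List.foldl_append,
    foldl_fifo_of_hits _ _ _ _ (List.range' _ _).reverse hc, List.foldl_cons, List.foldl_cons,
    List.foldl_nil, costStep_fifo_of_missing _ _ _ _ _ hc, ← List.cons_append,
    foldl_fifo_of_hits _ _ _ _ _ hc₁, foldl_fifo_of_hits _ _ _ _ _ hc₁,
    costStep_fifo_of_missing _ _ _ _ _ hc₁, foldl_fifo_of_hits _ _ _ _ _ hc₂]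
  all_goals
    intro p hp
    simp only [List.mem_reverse, List.mem_range'_1] at hp
    omega

lemma foldl_fifo_blockTail_last (m a : ℕ) (c : List ℕ)
    (hc : (1 :: (c ++ [2 * m + 2])).Perm (List.range' 1 (2 * m + 2))) :
    (blockTail (2 * m + 1)).foldl (costStep (fifoStep (2 * m + 1))) (c ++ [2 * m + 2], a) =
      (1 :: c, a + 1) := by
  have hc₁ := perm_evict _ _ _ _ hc
  rw [blockTail, List.range'_succ, List.reverse_cons, List.foldl_append, List.foldl_append,
    foldl_fifo_of_hits _ _ _ _ _ hc, List.foldl_cons, List.foldl_nil,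
    costStep_fifo_of_missing _ _ _ _ _ hc, foldl_fifo_of_hits _ _ _ _ _ hc₁]
  all_goals
    intro p hp
    simp only [List.mem_reverse, List.mem_range'_1] at hp
    omega

lemma foldl_fifo_blocks (m t : ℕ) : ∀ j a, t + j = m →
    ((t + 1) :: (zigzag m j ++ (2 * m + 2) :: zagIn m t)).Perm (List.range' 1 (2 * m + 2)) →
    (blockTail (2 * m + 1) ++ repeatList (pathBlock7 (2 * m + 1)) t).foldl
        (costStep (fifoStep (2 * m + 1))) (zigzag m j ++ (2 * m + 2) :: zagIn m t, a) =
      (1 :: zigzag m m, a + 2 * t + 1) := by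
  induction t with
  | zero =>
    intro j a hj hc
    obtain rfl : j = m := by omega
    rw [List.foldl_append]
    exact foldl_fifo_blockTail_last j a _ hc
  | succ t ih =>
    intro j a hj hc
    have e : zigzag m j ++ (2 * m + 2) :: zagIn m (t + 1) =
        (zigzag m j ++ (2 * m + 2) :: zagIn m t) ++ [t + 1, 2 * m + 1 - t] := by
      simp [zagIn]
    have e' : (2 * m + 1 - t) :: (t + 2) :: (zigzag m j ++ (2 * m + 2) :: zagIn m t) =
        zigzag m (j + 1) ++ (2 * m + 2) :: zagIn m t := by
      rw [zigzag, show m + j + 2 = 2 * m + 1 - t by omega, show m + 1 - j = t + 2 by omega]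
      simp
    rw [e] at hc ⊢
    have hc' : ((t + 1) :: (zigzag m (j + 1) ++ (2 * m + 2) :: zagIn m t)).Perm
        (List.range' 1 (2 * m + 2)) := by
      have h := hc
      rw [← e']
      rw [List.append_cons _ _ [2 * m + 1 - t]] at h
      have h₁ := perm_evict _ _ _ _ h
      rw [← List.cons_append] at h₁
      exact perm_evict _ _ _ _ h₁
    have hhit := foldl_fifo_of_hits (2 * m + 1) _ _ (a + 2) [2 * m + 2] hc'
      (by simp only [List.mem_singleton]; omega)
    rw [List.foldl_append, foldl_fifo_blockTail m t a (by omega) _ hc, e', repeatList_succ,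
      pathBlock7_eq_cons, List.cons_append, List.foldl_cons, ← pathBlock7_eq_cons]
    rw [List.foldl_cons, List.foldl_nil] at hhit
    rw [hhit, ih (j + 1) (a + 2) (by omega) hc']
    congr 1
    ring

/-- FIFO faults `k + 1` times on `J` and restores its cache. -/
lemma foldl_fifo_pathJ (m a : ℕ) :
    (pathJ (2 * m + 1)).foldl (costStep (fifoStep (2 * m + 1))) (1 :: zigzag m m, a) =
      (1 :: zigzag m m, a + (2 * m + 2)) := by
  have e := zagIn_append_zigzag m m 0 (by simp)
  rw [zigzag] at e
  have hc : ((2 * m + 2) :: (zagIn m m ++ [m + 1])).Perm (List.range' 1 (2 * m + 2)) := by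
    have h := cons_zigzag_perm m m le_rfl
    rw [Nat.add_sub_cancel_left, ← e] at h
    rw [List.range'_concat, show 1 + 1 * (2 * m + 1) = 2 * m + 2 by ring]
    exact (h.cons _).trans (List.perm_append_singleton _ _).symm
  rw [pathJ, show (2 * m + 1 + 1) / 2 = m + 1 by omega, repeatList_succ, pathBlock7_eq_cons,
    List.cons_append, List.foldl_cons, ← pathBlock7_eq_cons]
  have hs := foldl_fifo_blocks m m 0 (a + 1) (by simp) (perm_evict _ _ _ _ hc)
  rw [zigzag, List.nil_append] at hs
  rw [← e, costStep_fifo_of_missing _ _ _ _ _ hc, hs, e]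
  congr 1
  ring

/-- FWF faults on every request to a new page while there is room. -/
lemma foldl_fwf_of_fresh (k : ℕ) (L : List ℕ) : ∀ (c : List ℕ) (a : ℕ),
    (L.reverse ++ c).Nodup → L.length + c.length ≤ k →
    L.foldl (costStep (fwfStep k)) (c, a) = (L.reverse ++ c, a + L.length) := by
  induction L with
  | nil => simp
  | cons p L ih =>
    intro c a hnd hlen
    rw [List.reverse_cons, List.append_assoc, List.singleton_append] at hnd
    rw [List.length_cons] at hlen
    have hp : p ∉ c := (List.nodup_cons.1 (List.nodup_append.1 hnd).2.1).1
    have : costStep (fwfStep k) (c, a) p = (p :: c, a + 1) := by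
      simp [costStep, fwfStep_of_notMem_of_lt k c p hp (by omega)]
    rw [List.foldl_cons, this, ih (p :: c) (a + 1) hnd (by rw [List.length_cons]; omega)]
    simp [add_assoc, add_comm 1]

lemma costStep_fwf_of_full (k : ℕ) (c : List ℕ) (a p : ℕ) (hc : c.length = k) (hp : p ∉ c) :
    costStep (fwfStep k) (c, a) p = ([p], a + 1) := by
  simp [costStep, fwfStep, hp, hc]

/-- Starting from a full cache without page `k + 1`, FWF faults on every request of a block. -/
lemma foldl_fwf_pathBlock7 (k : ℕ) (hk : 1 ≤ k) (c : List ℕ) (a : ℕ)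
    (hc : c.length = k ∧ k + 1 ∉ c) :
    ∃ c' : List ℕ, (c'.length = k ∧ k + 1 ∉ c') ∧
      (pathBlock7 k).foldl (costStep (fwfStep k)) (c, a) = (c', a + 2 * k) := by
  obtain ⟨k, rfl⟩ : ∃ l, k = l + 1 := ⟨k - 1, by omega⟩
  refine ⟨(List.range' 2 k).reverse ++ [1], ⟨by simp, ?_⟩, ?_⟩
  · simp only [List.mem_append, List.mem_reverse, List.mem_range'_1, List.mem_singleton]
    omega
  · have h₁ := foldl_fwf_of_fresh (k + 1) (List.range' 2 k).reverse [k + 2] (a + 1)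
      (by
        rw [List.reverse_reverse, show k + 2 = 2 + 1 * k by ring, ← List.range'_concat]
        exact List.nodup_range')
      (by simp)
    have h₂ := foldl_fwf_of_fresh (k + 1) (List.range' 2 k) [1] (a + 1 + k + 1)
      (by
        rw [← List.reverse_cons, ← List.range'_succ (s := 1) (step := 1)]
        exact List.nodup_reverse.2 List.nodup_range')
      (by simp)
    rw [List.reverse_reverse, List.length_reverse, List.length_range'] at h₁
    rw [List.length_range'] at h₂
    rw [pathBlock7_eq_cons, blockTail, List.range'_succ, List.reverse_cons, Nat.add_sub_cancel,
      List.foldl_cons, costStep_fwf_of_full _ _ _ _ hc.1 hc.2, List.foldl_append,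
      List.foldl_append, h₁, List.foldl_cons, List.foldl_nil, costStep_fwf_of_full, h₂]
    · congr 1
      ring
    · simp
    · simp only [List.mem_append, List.mem_range'_1, List.mem_singleton]
      omega

lemma length_pathJ (m : ℕ) :
    (pathJ (2 * m + 1)).length = 2 * (2 * m + 1) * (m + 1) := by
  rw [pathJ, length_repeatList, pathBlock7, show (2 * m + 1 + 1) / 2 = m + 1 by omega]
  simp
  ring

lemma fifoCost_pathI7 (m n : ℕ) :
    fifoCost (2 * m + 1) (pathI7 (2 * m + 1) n) =
      fifoCost (2 * m + 1) (pathR (2 * m + 1)) + (2 * m + 2) * n := by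
  have hR := foldl_pathR _ m (fifoStep_of_mem (2 * m + 1)) (fifoStep_of_notMem_of_lt (2 * m + 1))
  obtain ⟨c, -, h⟩ := foldl_repeatList_of_fixed (costStep (fifoStep (2 * m + 1)))
    (pathJ (2 * m + 1)) (· = 1 :: zigzag m m) (2 * m + 2)
    (by rintro _ a rfl; exact ⟨_, rfl, foldl_fifo_pathJ m a⟩) n _ (2 * m + 1) rfl
  rw [fifoCost, fifoCost, runCost_eq_foldl, runCost_eq_foldl, pathI7, List.foldl_append, hR, h]

lemma fwfCost_pathI7 (m n : ℕ) :
    fwfCost (2 * m + 1) (pathI7 (2 * m + 1) n) =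
      fwfCost (2 * m + 1) (pathR (2 * m + 1)) + 2 * (2 * m + 1) * (m + 1) * n := by
  have hR := foldl_pathR _ m (fwfStep_of_mem (2 * m + 1)) (fwfStep_of_notMem_of_lt (2 * m + 1))
  have hJ := foldl_repeatList_of_fixed (costStep (fwfStep (2 * m + 1)))
    (pathBlock7 (2 * m + 1)) (fun c => c.length = 2 * m + 1 ∧ 2 * m + 1 + 1 ∉ c)
    (2 * (2 * m + 1)) (foldl_fwf_pathBlock7 (2 * m + 1) (by omega)) (m + 1)
  have hc := cons_zigzag_perm m m le_rfl
  rw [Nat.add_sub_cancel_left] at hc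
  obtain ⟨c, -, h⟩ := foldl_repeatList_of_fixed (costStep (fwfStep (2 * m + 1)))
    (pathJ (2 * m + 1)) (fun c => c.length = 2 * m + 1 ∧ 2 * m + 1 + 1 ∉ c) _
    (by rw [pathJ, show (2 * m + 1 + 1) / 2 = m + 1 by omega]; exact hJ) n (1 :: zigzag m m)
    (2 * m + 1) ⟨by simpa using hc.length_eq, by rw [hc.mem_iff, List.mem_range'_1]; omega⟩
  rw [fwfCost, fwfCost, runCost_eq_foldl, runCost_eq_foldl, pathI7, List.foldl_append, hR, h]

open Filter in
/-- For `k` odd, after the initializing prefix `R`, FIFO faults exactly `k+1`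
times on each copy of `J`, so FIFO's cost on `K_n` is `(k+1)n` while FWF's cost
on `K_n` is `2khn` (with `h = (k+1)/2`), and
`(FWF(I_n) − FIFO(I_n))/|I_n| → (k−1)/k`. -/
theorem stmt7 (k : ℕ) (hk : 3 ≤ k) (hodd : Odd k) :
    (∀ n, fifoCost k (pathI7 k n) = fifoCost k (pathR k) + (k + 1) * n ∧
      fwfCost k (pathI7 k n) = fwfCost k (pathR k) + 2 * k * ((k + 1) / 2) * n) ∧
    Tendsto
      (fun n : ℕ =>
        ((fwfCost k (pathI7 k n) : ℝ) - (fifoCost k (pathI7 k n) : ℝ)) /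
          ((pathI7 k n).length : ℝ))
      atTop (nhds (((k : ℝ) - 1) / k)) := by
  obtain ⟨m, rfl⟩ := hodd
  refine ⟨fun n => ⟨fifoCost_pathI7 m n, ?_⟩, ?_⟩
  · rw [fwfCost_pathI7, show (2 * m + 1 + 1) / 2 = m + 1 by omega]
  · have h := tendsto_add_mul_div_add_mul_atTop_nhds
      ((fwfCost (2 * m + 1) (pathR (2 * m + 1)) : ℝ) - fifoCost (2 * m + 1) (pathR (2 * m + 1)))
      ((pathR (2 * m + 1)).length : ℝ) (2 * (2 * m + 1) * (m + 1) - (2 * m + 2) : ℝ)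
      (d := 2 * (2 * m + 1) * (m + 1)) (by positivity)
    convert h using 2 with n
    · rw [fwfCost_pathI7, fifoCost_pathI7, pathI7, List.length_append, length_repeatList,
        length_pathJ]
      push_cast
      ring
    · push_cast
      field_simp
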